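/- arXiv:2402.11309 — 4 statements merged into one kernel-verified Lean document; each statement's English description precedes it below -/
import Mathlib

section
/- (Square-root moment differential equation, Lemma 1.) Let n be a positive integer and let S : ℝ → Matrix (Fin n) (Fin n) ℝ be differentiable on an interval [a,b], with S(t) lower triangular and invertible for every t in [a,b]. Define P(t) = S(t)·S(t)ᵀ and M(t) = P′(t). Then for every t in [a,b], the derivative of the Cholesky factor satisfies S′(t) = S(t) · Φ( S(t)⁻¹ · M(t) · (S(t)ᵀ)⁻¹ ). -/
open Matrix

attribute [local instance] Matrix.normedAddCommGroup Matrix.normedSpace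

/-- A matrix is lower triangular if all entries strictly above the diagonal vanish. -/
def lowerTriangular {k : ℕ} (M : Matrix (Fin k) (Fin k) ℝ) : Prop :=
  ∀ i j : Fin k, i < j → M i j = 0

/-- The operator Φ(A) = L̄ + (1/2)D, where A = L̄ + D + Ū is split into the strictly
lower triangular, diagonal and strictly upper triangular parts. -/
noncomputable def Phi {k : ℕ} (A : Matrix (Fin k) (Fin k) ℝ) : Matrix (Fin k) (Fin k) ℝ :=
  Matrix.of fun i j => if j < i then A i j else if i = j then A i j / 2 else 0

/-- Square-root moment differential equation (Lemma 1): if the lower triangular,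
invertible Cholesky factor `S t` of `P t = S t * (S t)ᵀ` is differentiable on `[a, b]`
and `M t = P′ t`, then `S′ t = S t * Φ((S t)⁻¹ * M t * ((S t)ᵀ)⁻¹)` on `[a, b]`. -/
theorem sqrt_MDE {n : ℕ} (hn : 0 < n) (a b : ℝ) (hab : a < b)
    (S S' : ℝ → Matrix (Fin n) (Fin n) ℝ)
    (hS : ∀ t ∈ Set.Icc a b, HasDerivAt S (S' t) t)
    (hlow : ∀ t ∈ Set.Icc a b, lowerTriangular (S t))
    (hinv : ∀ t ∈ Set.Icc a b, IsUnit (S t))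
    (P M : ℝ → Matrix (Fin n) (Fin n) ℝ)
    (hP : ∀ t, P t = S t * (S t)ᵀ)
    (hM : ∀ t ∈ Set.Icc a b, HasDerivAt P (M t) t) :
    ∀ t ∈ Set.Icc a b, S' t = S t * Phi ((S t)⁻¹ * M t * ((S t)ᵀ)⁻¹) := by
  intro t ht
  have ent : ∀ (F : ℝ → Matrix (Fin n) (Fin n) ℝ) (F' : Matrix (Fin n) (Fin n) ℝ),
      HasDerivAt F F' t → ∀ i j, HasDerivAt (fun s => F s i j) (F' i j) t := by
    intro F F' h i j
    exact hasDerivAt_pi.1 (hasDerivAt_pi.1 h i) j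
  have hlow' : lowerTriangular (S' t) := by
    intro i j hij
    have h1 := (ent S _ (hS t ht) i j).hasDerivWithinAt (s := Set.Icc a b)
    have h2 : HasDerivWithinAt (fun s => S s i j) 0 (Set.Icc a b) t :=
      (hasDerivWithinAt_const t (Set.Icc a b) (0:ℝ)).congr
        (fun s hs => hlow s hs i j hij) (hlow t ht i j hij)
    exact (uniqueDiffOn_Icc hab t ht).eq_deriv _ h1 h2
  have hMt : M t = S' t * (S t)ᵀ + S t * (S' t)ᵀ := by
    ext i j
    have h1 := ent P _ (hM t ht) i j
    have h2 : HasDerivAt (fun s => P s i j)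
        (∑ k, (S' t i k * S t j k + S t i k * S' t j k)) t := by
      have : (fun s => P s i j) = fun s => ∑ k, S s i k * S s j k := by
        funext s
        simp [hP, Matrix.mul_apply]
      rw [this]
      exact HasDerivAt.fun_sum fun k _ =>
        (ent S _ (hS t ht) i k).mul (ent S _ (hS t ht) j k)
    rw [h1.unique h2]
    simp [Matrix.mul_apply, Finset.sum_add_distrib]
  have hdet : IsUnit (S t).det := (Matrix.isUnit_iff_isUnit_det _).1 (hinv t ht)
  have hdetT : IsUnit ((S t)ᵀ).det := by rwa [Matrix.det_transpose]
  set B := (S t)⁻¹ * S' t with hB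
  have hBlow : ∀ i j, i < j → B i j = 0 := by
    have b1 : BlockTriangular (S t) (OrderDual.toDual : Fin n → (Fin n)ᵒᵈ) :=
      fun i j h => hlow t ht i j h
    have b2 : BlockTriangular (S' t) (OrderDual.toDual : Fin n → (Fin n)ᵒᵈ) :=
      fun i j h => hlow' i j h
    haveI : Invertible (S t) := (hinv t ht).invertible
    have b3 := (blockTriangular_inv_of_blockTriangular b1).mul b2
    exact fun i j h => b3 h
  have hA : (S t)⁻¹ * M t * ((S t)ᵀ)⁻¹ = B + Bᵀ := by
    rw [hMt, mul_add, add_mul, hB, Matrix.transpose_mul, Matrix.transpose_nonsing_inv,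
      ← Matrix.mul_assoc, ← Matrix.mul_assoc, Matrix.mul_nonsing_inv_cancel_right _ _ hdetT,
      Matrix.nonsing_inv_mul _ hdet, Matrix.one_mul]
  have hPhi : Phi (B + Bᵀ) = B := by
    ext i j
    simp only [Phi, Matrix.of_apply, Matrix.add_apply, Matrix.transpose_apply]
    split_ifs with h1 h2
    · rw [hBlow j i h1, add_zero]
    · subst h2; ring
    · exact (hBlow i j (lt_of_le_of_ne (not_lt.1 h1) h2)).symm
  rw [hA, hPhi, hB, Matrix.mul_nonsing_inv_cancel_left _ _ hdet]
end

section
/- (Sample point differential equations, Lemma 2.) Let n be a positive integer, α > 0, and let S : ℝ → Matrix (Fin n) (Fin n) ℝ be differentiable on an interval [a,b] with S(t) lower triangular and invertible for every t. Let P(t) = S(t)·S(t)ᵀ and M(t) = P′(t). Let x̂ : ℝ → ℝⁿ be differentiable with x̂′(t) = f(t, x̂(t)) for a function f : ℝ × ℝⁿ → ℝⁿ. Define the sample-point matrix 𝕏(t) := x̂(t)·𝟙ᵀ + (√n/α)·S(t), where 𝟙 ∈ ℝⁿ is the all-ones column vector (so the i-th column of 𝕏(t) is x̂(t) + (√n/α)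 times the i-th column of S(t)). Then 𝕏 is differentiable on [a,b] and 𝕏′(t) = f(t, x̂(t))·𝟙ᵀ + (√n/α) · S(t) · Φ( S(t)⁻¹ · M(t) · (S(t)ᵀ)⁻¹ ). -/
open Matrix

attribute [local instance] Matrix.normedAddCommGroup Matrix.normedSpace

/-- The matrix `v·𝟙ᵀ` each of whose columns equals the vector `v`. -/
def colRep {k : ℕ} (v : Fin k → ℝ) : Matrix (Fin k) (Fin k) ℝ :=
  Matrix.of fun i _ => v i

theorem spde_deriv_iff {n : ℕ} (F : ℝ → Matrix (Fin n) (Fin n) ℝ)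
    (F' : Matrix (Fin n) (Fin n) ℝ) (t : ℝ) :
    HasDerivAt F F' t ↔ ∀ i j, HasDerivAt (fun s => F s i j) (F' i j) t := by
  have h1 : HasDerivAt F F' t ↔ ∀ i, HasDerivAt (fun s => F s i) (F' i) t :=
    hasDerivAt_pi (φ := F) (φ' := F')
  rw [h1]
  exact forall_congr' fun i => hasDerivAt_pi

theorem spde_low_iff {n : ℕ} (A : Matrix (Fin n) (Fin n) ℝ) :
    lowerTriangular A ↔ A.BlockTriangular OrderDual.toDual :=
  ⟨fun h i j hij => h i j hij, fun h i j hij => h hij⟩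

theorem spde_phi {n : ℕ} (B : Matrix (Fin n) (Fin n) ℝ) (hB : lowerTriangular B) :
    Phi (B + Bᵀ) = B := by
  ext i j
  simp only [Phi, Matrix.of_apply, Matrix.add_apply, Matrix.transpose_apply]
  rcases lt_trichotomy i j with h | h | h
  · rw [if_neg (not_lt.2 h.le), if_neg h.ne, hB i j h]
  · subst h
    simp
  · rw [if_pos h, hB j i h, add_zero]

/-- Sample point differential equations (Lemma 2): with `𝕏 t = x̂ t · 𝟙ᵀ + (√n/α) S t`,
where `x̂′ = f(t, x̂)` and `S` is the lower triangular invertible Cholesky factor of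
`P = S Sᵀ` with `M = P′`, the sample-point matrix `𝕏` is differentiable on `[a, b]` and
`𝕏′ t = f(t, x̂ t)·𝟙ᵀ + (√n/α) S t Φ((S t)⁻¹ M t ((S t)ᵀ)⁻¹)`. -/
theorem SPDE {n : ℕ} (hn : 0 < n) (α : ℝ) (hα : 0 < α) (a b : ℝ) (hab : a < b)
    (S S' : ℝ → Matrix (Fin n) (Fin n) ℝ)
    (hS : ∀ t ∈ Set.Icc a b, HasDerivAt S (S' t) t)
    (hlow : ∀ t ∈ Set.Icc a b, lowerTriangular (S t))
    (hinv : ∀ t ∈ Set.Icc a b, IsUnit (S t))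
    (P M : ℝ → Matrix (Fin n) (Fin n) ℝ)
    (hP : ∀ t, P t = S t * (S t)ᵀ)
    (hM : ∀ t ∈ Set.Icc a b, HasDerivAt P (M t) t)
    (f : ℝ → (Fin n → ℝ) → (Fin n → ℝ))
    (xhat : ℝ → Fin n → ℝ)
    (hx : ∀ t ∈ Set.Icc a b, HasDerivAt xhat (f t (xhat t)) t)
    (X : ℝ → Matrix (Fin n) (Fin n) ℝ)
    (hX : ∀ t, X t = colRep (xhat t) + (Real.sqrt n / α) • S t) :
    ∀ t ∈ Set.Icc a b,
      HasDerivAt X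
        (colRep (f t (xhat t)) +
          (Real.sqrt n / α) • (S t * Phi ((S t)⁻¹ * M t * ((S t)ᵀ)⁻¹))) t := by
  intro t ht
  have hS'low : lowerTriangular (S' t) := by
    intro i j hij
    have h1 := ((spde_deriv_iff _ _ _).1 (hS t ht) i j).hasDerivWithinAt (s := Set.Icc a b)
    have h2 : HasDerivWithinAt (fun s => S s i j) 0 (Set.Icc a b) t :=
      (hasDerivWithinAt_const t (Set.Icc a b) (0 : ℝ)).congr
        (fun s hs => hlow s hs i j hij) (hlow t ht i j hij)
    exact (uniqueDiffOn_Icc hab t ht).eq_deriv _ h1 h2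
  have hMt : M t = S' t * (S t)ᵀ + S t * (S' t)ᵀ := by
    refine (hM t ht).unique ((spde_deriv_iff _ _ _).2 fun i j => ?_)
    have hd := (spde_deriv_iff _ _ _).1 (hS t ht)
    have h3 := HasDerivAt.fun_sum (u := Finset.univ)
      (fun k (_ : k ∈ Finset.univ) => (hd i k).fun_mul (hd j k))
    have e1 : (fun s => P s i j) = fun s => ∑ k, S s i k * S s j k := by
      funext s
      rw [hP, Matrix.mul_apply]
      rfl
    have e2 : (S' t * (S t)ᵀ + S t * (S' t)ᵀ) i j
        = ∑ k, (S' t i k * S t j k + S t i k * S' t j k) := by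
      simp [Matrix.mul_apply, Finset.sum_add_distrib]
    rw [e1, e2]
    exact h3
  have hdet : IsUnit (S t).det := (Matrix.isUnit_iff_isUnit_det _).1 (hinv t ht)
  have hdetT : IsUnit ((S t)ᵀ).det := by rwa [Matrix.det_transpose]
  have hB : lowerTriangular ((S t)⁻¹ * S' t) := by
    rw [spde_low_iff]
    haveI := (hinv t ht).invertible
    exact (Matrix.blockTriangular_inv_of_blockTriangular
      ((spde_low_iff _).1 (hlow t ht))).mul ((spde_low_iff _).1 hS'low)
  have hkey : S t * Phi ((S t)⁻¹ * M t * ((S t)ᵀ)⁻¹) = S' t := by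
    have e : (S t)⁻¹ * M t * ((S t)ᵀ)⁻¹ = (S t)⁻¹ * S' t + ((S t)⁻¹ * S' t)ᵀ := by
      rw [hMt, Matrix.mul_add, Matrix.add_mul, ← Matrix.mul_assoc, ← Matrix.mul_assoc,
        Matrix.mul_nonsing_inv_cancel_right _ _ hdetT, Matrix.nonsing_inv_mul _ hdet,
        Matrix.one_mul, Matrix.transpose_mul, Matrix.transpose_nonsing_inv]
    rw [e, spde_phi _ hB, Matrix.mul_nonsing_inv_cancel_left _ _ hdet]
  rw [hkey, spde_deriv_iff]
  intro i j
  have h4 := (hasDerivAt_pi.1 (hx t ht) i).fun_add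
    (((spde_deriv_iff _ _ _).1 (hS t ht) i j).const_mul (Real.sqrt n / α))
  have e3 : (fun s => X s i j) = fun s => xhat s i + Real.sqrt n / α * S s i j := by
    funext s
    rw [hX]
    rfl
  rw [e3]
  exact h4
end

section
/- (First-order convergence of the derivative-free cross-covariance approximation.) Let n, m be positive integers, x̂ ∈ ℝⁿ, ξ₁,…,ξₙ ∈ ℝⁿ with P = (1/n)·Σᵢ ξᵢ·ξᵢᵀ, and let h : ℝⁿ → ℝᵐ be differentiable at x̂ with derivative H = Dh(x̂) (an m×n matrix). Then, as α → ∞ (α real, α > 0), the derivative-free approximation of the cross-covariance converges to the linearized EKF expression: limit of (α²/n)·Σᵢ ( (1/α)·ξᵢ )·( h(x̂ + (1/α)·ξᵢ) − h(x̂) )ᵀ equals P·Hᵀ. -/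
open Matrix Topology Filter

/-- First-order convergence of the derivative-free cross-covariance approximation:
if `P = (1/n) Σᵢ ξᵢ ξᵢᵀ` and `h` is differentiable at `x̂` with Jacobian matrix `H`,
then `(α²/n) Σᵢ ((1/α) ξᵢ)(h(x̂ + (1/α) ξᵢ) - h(x̂))ᵀ → P Hᵀ` as `α → ∞`. -/
theorem derivative_free_cross_covariance_limit {n m : ℕ} (hn : 0 < n) (hm : 0 < m)
    (xhat : Fin n → ℝ) (ξ : Fin n → Fin n → ℝ)
    (P : Matrix (Fin n) (Fin n) ℝ)
    (hP : P = (1 / (n : ℝ)) • ∑ i, vecMulVec (ξ i) (ξ i))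
    (h : (Fin n → ℝ) → (Fin m → ℝ))
    (H : Matrix (Fin m) (Fin n) ℝ)
    (hd : HasFDerivAt h (LinearMap.toContinuousLinearMap (Matrix.mulVecLin H)) xhat) :
    Tendsto
      (fun α : ℝ => ((α ^ 2) / (n : ℝ)) •
        ∑ i, vecMulVec ((1 / α) • ξ i) (h (xhat + (1 / α) • ξ i) - h xhat))
      atTop (𝓝 (P * Hᵀ)) := by
  have key : ∀ i, Tendsto (fun c : ℝ => c • (h (xhat + c⁻¹ • ξ i) - h xhat)) atTop
      (𝓝 (H *ᵥ ξ i)) := fun i => by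
    simpa using hd.lim_real (ξ i)
  have hlim : P * Hᵀ = (1 / (n : ℝ)) • ∑ i, vecMulVec (ξ i) (H *ᵥ ξ i) := by
    rw [hP, Matrix.smul_mul, Matrix.sum_mul]
    simp only [vecMulVec_mul, vecMul_transpose]
  rw [hlim]
  have hT : Tendsto (fun c : ℝ => (1 / (n : ℝ)) • ∑ i,
      vecMulVec (ξ i) (c • (h (xhat + c⁻¹ • ξ i) - h xhat))) atTop
      (𝓝 ((1 / (n : ℝ)) • ∑ i, vecMulVec (ξ i) (H *ᵥ ξ i))) := by
    refine Tendsto.const_smul (tendsto_finsetSum _ fun i _ => ?_) _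
    exact ((continuous_const.matrix_vecMulVec continuous_id).tendsto _).comp (key i)
  refine hT.congr' ?_
  filter_upwards [eventually_ne_atTop (0 : ℝ)] with α hα
  simp only [Finset.smul_sum, one_div, smul_vecMulVec, vecMulVec_smul, smul_smul]
  refine Finset.sum_congr rfl fun i _ => ?_
  congr 1
  field_simp
end

section
/- (First-order convergence of the derivative-free residual-covariance approximation.) Let n, m be positive integers, x̂ ∈ ℝⁿ, ξ₁,…,ξₙ ∈ ℝⁿ with P = (1/n)·Σᵢ ξᵢ·ξᵢᵀ, and let h : ℝⁿ → ℝᵐ be differentiable at x̂ with derivative H = Dh(x̂) (an m×n matrix). Then, as α → ∞ (α real, α > 0), the derivative-free approximation of the innovation covariance converges to the linearized EKF expression: limit of (α²/n)·Σᵢ ( h(x̂ + (1/α)·ξᵢ) − h(x̂) )·( h(x̂ + (1/α)·ξᵢ) − h(x̂) )ᵀ equals H·P·Hᵀ. -/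
open Matrix Topology Filter

/-- First-order convergence of the derivative-free residual-covariance approximation:
if `P = (1/n) Σᵢ ξᵢ ξᵢᵀ` and `h` is differentiable at `x̂` with Jacobian matrix `H`,
then `(α²/n) Σᵢ (h(x̂ + (1/α) ξᵢ) - h(x̂))(h(x̂ + (1/α) ξᵢ) - h(x̂))ᵀ → H P Hᵀ`
as `α → ∞`. -/
theorem derivative_free_residual_covariance_limit {n m : ℕ} (hn : 0 < n) (hm : 0 < m)
    (xhat : Fin n → ℝ) (ξ : Fin n → Fin n → ℝ)
    (P : Matrix (Fin n) (Fin n) ℝ)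
    (hP : P = (1 / (n : ℝ)) • ∑ i, vecMulVec (ξ i) (ξ i))
    (h : (Fin n → ℝ) → (Fin m → ℝ))
    (H : Matrix (Fin m) (Fin n) ℝ)
    (hd : HasFDerivAt h (LinearMap.toContinuousLinearMap (Matrix.mulVecLin H)) xhat) :
    Tendsto
      (fun α : ℝ => ((α ^ 2) / (n : ℝ)) •
        ∑ i, vecMulVec (h (xhat + (1 / α) • ξ i) - h xhat)
          (h (xhat + (1 / α) • ξ i) - h xhat))
      atTop (𝓝 (H * P * Hᵀ)) := by
  have key : ∀ i, Tendsto (fun α : ℝ => α • (h (xhat + (1 / α) • ξ i) - h xhat)) atTop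
      (𝓝 (H *ᵥ ξ i)) := by
    intro i
    have := hd.lim (ξ i) (c := fun α : ℝ => α) (l := atTop) tendsto_norm_atTop_atTop
    simpa using this
  have hlim : H * P * Hᵀ = (1 / (n : ℝ)) • ∑ i, vecMulVec (H *ᵥ ξ i) (H *ᵥ ξ i) := by
    rw [hP, Matrix.mul_smul, Matrix.smul_mul, Matrix.mul_sum, Matrix.sum_mul]
    congr 1
    refine Finset.sum_congr rfl fun i _ => ?_
    rw [Matrix.mul_vecMulVec, Matrix.vecMulVec_mul, Matrix.vecMul_transpose]
  have hfun : (fun α : ℝ => ((α ^ 2) / (n : ℝ)) •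
        ∑ i, vecMulVec (h (xhat + (1 / α) • ξ i) - h xhat)
          (h (xhat + (1 / α) • ξ i) - h xhat)) =
      fun α : ℝ => (1 / (n : ℝ)) • ∑ i, vecMulVec (α • (h (xhat + (1 / α) • ξ i) - h xhat))
          (α • (h (xhat + (1 / α) • ξ i) - h xhat)) := by
    funext α
    simp only [Matrix.smul_vecMulVec, Matrix.vecMulVec_smul, ← Finset.smul_sum, smul_smul]
    congr 1
    ring
  rw [hlim, hfun]
  refine Tendsto.const_smul (tendsto_finsetSum _ fun i _ => ?_) _
  have hc : Continuous fun v : Fin m → ℝ => vecMulVec v v :=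
    continuous_id.matrix_vecMulVec continuous_id
  exact (hc.tendsto _).comp (key i)
end
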